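/- (Polynomial-in-n kernel bounds.) Let τ > 0, T = Nτ with N ∈ ℕ, and K = ⌈T/τ⌉. Let L > 0, a₁, a₂ > 0, d₁, d₂ ∈ ℝ, and suppose (nπa₁/L)² − d₁ > 0 and (nπa₂/L)² − d₂ > 0 for all positive integers n; set ωₙ = √((nπa₁/L)² − d₁) and υₙ = √((nπa₂/L)² − d₂). Then there exists a constant M > 0 (depending on T but not on n) such that for all positive integers n and all t ∈ [0,T]: |C_τ^{−ωₙ²,−υₙ²}(t)| ≤ M·n^K, |S_τ^{−ωₙ²,−υₙ²}(t)| ≤ M·n^{K−1}, and |υₙ²·S_τ^{−ωₙ²,−υₙ²}(t)| ≤ M·n^{K+1}. -/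

import Mathlib

/-- Single term of the double series defining the delayed perturbation cosine function. -/
noncomputable def Cterm (τ a b t : ℝ) (k m : ℕ) : ℝ :=
  if k ≤ m then
    (m.choose k : ℝ) * a ^ (m - k) * b ^ k * (max (t - (k : ℝ) * τ) 0) ^ (2 * m) /
      (Nat.factorial (2 * m) : ℝ)
  else 0

/-- Single term of the double series defining the delayed perturbation sine function. -/
noncomputable def Sterm (τ a b t : ℝ) (k m : ℕ) : ℝ :=
  if k ≤ m then
    (m.choose k : ℝ) * a ^ (m - k) * b ^ k * (max (t - (k : ℝ) * τ) 0) ^ (2 * m + 1) /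
      (Nat.factorial (2 * m + 1) : ℝ)
  else 0

/-- The delayed perturbation cosine-type function `C_τ^{a,b}`, extended by `0` for `t < 0`. -/
noncomputable def Cdel (τ a b : ℝ) (t : ℝ) : ℝ :=
  if t < 0 then 0 else ∑' k : ℕ, ∑' m : ℕ, Cterm τ a b t k m

/-- The delayed perturbation sine-type function `S_τ^{a,b}`, extended by `0` for `t < 0`. -/
noncomputable def Sdel (τ a b : ℝ) (t : ℝ) : ℝ :=
  if t < 0 then 0 else ∑' k : ℕ, ∑' m : ℕ, Sterm τ a b t k m

/-- The power series `∑ m, c m * y ^ (2 * m + e) / (2 * m + e)!`. -/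
noncomputable def strideTwoSeries (c : ℕ → ℝ) (e : ℕ) (y : ℝ) : ℝ :=
  ∑' m : ℕ, c m * (y ^ (2 * m + e) / (Nat.factorial (2 * m + e) : ℝ))

/-- The coefficients `binom(m, k) a ^ (m - k)` of the `k`-th delay kernel. -/
noncomputable def delayCoeff (a : ℝ) (k m : ℕ) : ℝ := (m.choose k : ℝ) * a ^ (m - k)

lemma abs_strideTwo_term_le {c : ℕ → ℝ} {D B : ℝ} (hc : ∀ m, |c m| ≤ D * B ^ m)
    (e : ℕ) {y R : ℝ} (hy : |y| ≤ R) (m : ℕ) :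
    |c m * (y ^ (2 * m + e) / (Nat.factorial (2 * m + e) : ℝ))| ≤
      D * R ^ e * ((B * R ^ 2) ^ m / (Nat.factorial m : ℝ)) := by
  have hf : (Nat.factorial m : ℝ) ≤ (Nat.factorial (2 * m + e) : ℝ) := by
    exact_mod_cast Nat.factorial_le (by omega)
  have hm : (0 : ℝ) < Nat.factorial m := by exact_mod_cast Nat.factorial_pos m
  have hR : 0 ≤ R := (abs_nonneg y).trans hy
  rw [abs_mul, abs_div, abs_pow, Nat.abs_cast]
  calc |c m| * (|y| ^ (2 * m + e) / (Nat.factorial (2 * m + e) : ℝ))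
      ≤ (D * B ^ m) * (R ^ (2 * m + e) / (Nat.factorial m : ℝ)) := by
        apply mul_le_mul (hc m) _ (by positivity) ((abs_nonneg _).trans (hc m))
        gcongr
    _ = _ := by rw [mul_pow, pow_add, pow_mul]; ring

lemma summable_strideTwo {c : ℕ → ℝ} {D B : ℝ} (hc : ∀ m, |c m| ≤ D * B ^ m) (e : ℕ) (y : ℝ) :
    Summable fun m : ℕ => c m * (y ^ (2 * m + e) / (Nat.factorial (2 * m + e) : ℝ)) :=
  .of_norm_bounded ((Real.summable_pow_div_factorial (B * |y| ^ 2)).mul_left (D * |y| ^ e))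
    fun m => abs_strideTwo_term_le hc e le_rfl m

lemma hasDerivAt_pow_div_factorial (j : ℕ) (x : ℝ) :
    HasDerivAt (fun y : ℝ => y ^ (j + 1) / (Nat.factorial (j + 1) : ℝ))
      (x ^ j / (Nat.factorial j : ℝ)) x := by
  have h := (hasDerivAt_pow (j + 1) x).div_const (Nat.factorial (j + 1) : ℝ)
  have hj : (Nat.factorial j : ℝ) ≠ 0 := by exact_mod_cast Nat.factorial_ne_zero _
  have hj1 : ((j : ℝ) + 1) ≠ 0 := by positivity
  have heq : x ^ j / (Nat.factorial j : ℝ) =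
      ((j + 1 : ℕ) : ℝ) * x ^ (j + 1 - 1) / (Nat.factorial (j + 1) : ℝ) := by
    rw [Nat.factorial_succ, Nat.add_sub_cancel]
    push_cast
    field_simp
  rw [heq]
  exact h

lemma hasDerivAt_strideTwoSeries_succ {c : ℕ → ℝ} {D B : ℝ} (hc : ∀ m, |c m| ≤ D * B ^ m)
    (e : ℕ) (y : ℝ) :
    HasDerivAt (strideTwoSeries c (e + 1)) (strideTwoSeries c e y) y := by
  obtain ⟨R, hR⟩ : ∃ R, |y| < R := exists_gt _
  have hmem : y ∈ Metric.ball (0 : ℝ) R := by simpa using hR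
  exact hasDerivAt_tsum_of_isPreconnected
    (g := fun m x => c m * (x ^ (2 * m + (e + 1)) / (Nat.factorial (2 * m + (e + 1)) : ℝ)))
    (g' := fun m x => c m * (x ^ (2 * m + e) / (Nat.factorial (2 * m + e) : ℝ)))
    ((Real.summable_pow_div_factorial (B * R ^ 2)).mul_left (D * R ^ e)) Metric.isOpen_ball
    (convex_ball (0 : ℝ) R).isPreconnected
    (fun m x _ => (hasDerivAt_pow_div_factorial (2 * m + e) x).const_mul (c m))
    (fun m x hx => abs_strideTwo_term_le hc e (by simpa using (mem_ball_zero_iff.mp hx).le) m)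
    hmem (summable_strideTwo hc (e + 1) y) hmem

lemma hasDerivAt_strideTwoSeries_zero {c : ℕ → ℝ} {D B : ℝ} (hc : ∀ m, |c m| ≤ D * B ^ m)
    (y : ℝ) :
    HasDerivAt (strideTwoSeries c 0) (strideTwoSeries (fun m => c (m + 1)) 1 y) y := by
  have hc' : ∀ m, |c (m + 1)| ≤ (D * B) * B ^ m := fun m => by
    simpa [pow_succ, mul_assoc, mul_comm] using hc (m + 1)
  have heq : strideTwoSeries c 0 =
      fun y => c 0 + strideTwoSeries (fun m => c (m + 1)) 2 y := by
    funext x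
    unfold strideTwoSeries
    rw [(summable_strideTwo hc 0 x).tsum_eq_zero_add]
    simp [mul_add]
  rw [heq]
  exact (hasDerivAt_strideTwoSeries_succ hc' 1 y).const_add _

lemma abs_delayCoeff_le (a : ℝ) (k m : ℕ) :
    |delayCoeff a k m| ≤ 1 * (2 * max |a| 1) ^ m := by
  rw [delayCoeff, abs_mul, abs_pow, Nat.abs_cast, one_mul, mul_pow]
  have h1 : (m.choose k : ℝ) ≤ 2 ^ m := by exact_mod_cast Nat.choose_le_two_pow m k
  have h2 : |a| ^ (m - k) ≤ (max |a| 1) ^ m :=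
    (pow_le_pow_left₀ (abs_nonneg a) (le_max_left _ 1) _).trans
      (pow_le_pow_right₀ (le_max_right _ _) (Nat.sub_le m k))
  exact mul_le_mul h1 h2 (by positivity) (by positivity)

lemma delayCoeff_zero_succ (a : ℝ) (m : ℕ) :
    delayCoeff a 0 (m + 1) = a * delayCoeff a 0 m := by
  simp [delayCoeff, pow_succ']

lemma delayCoeff_succ_succ (a : ℝ) (k m : ℕ) :
    delayCoeff a (k + 1) (m + 1) = a * delayCoeff a (k + 1) m + delayCoeff a k m := by
  unfold delayCoeff
  rw [Nat.choose_succ_succ, Nat.add_sub_add_right]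
  rcases lt_or_ge m (k + 1) with h | h
  · simp [Nat.choose_eq_zero_of_lt h]
  · obtain ⟨j, rfl⟩ := Nat.exists_eq_add_of_le h
    rw [show k + 1 + j - k = j + 1 by omega, show k + 1 + j - (k + 1) = j by omega]
    push_cast
    ring

lemma strideTwoSeries_zero_arg_one (c : ℕ → ℝ) : strideTwoSeries c 1 0 = 0 := by
  simp [strideTwoSeries]

lemma strideTwoSeries_zero_arg_zero (c : ℕ → ℝ) : strideTwoSeries c 0 0 = c 0 := by
  unfold strideTwoSeries
  rw [tsum_eq_single 0 fun m hm => by simp [hm]]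
  simp

lemma hasDerivAt_delayCoeff_zero (a y : ℝ) :
    HasDerivAt (strideTwoSeries (delayCoeff a 0) 0)
      (a * strideTwoSeries (delayCoeff a 0) 1 y) y := by
  convert hasDerivAt_strideTwoSeries_zero (abs_delayCoeff_le a 0) y using 1
  simp only [strideTwoSeries, delayCoeff_zero_succ, mul_assoc, tsum_mul_left]

lemma hasDerivAt_delayCoeff_succ (a : ℝ) (k : ℕ) (y : ℝ) :
    HasDerivAt (strideTwoSeries (delayCoeff a (k + 1)) 0)
      (a * strideTwoSeries (delayCoeff a (k + 1)) 1 y + strideTwoSeries (delayCoeff a k) 1 y)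
      y := by
  convert hasDerivAt_strideTwoSeries_zero (abs_delayCoeff_le a (k + 1)) y using 1
  simp only [strideTwoSeries, delayCoeff_succ_succ, add_mul, mul_assoc]
  rw [Summable.tsum_add ((summable_strideTwo (abs_delayCoeff_le a (k + 1)) 1 y).mul_left a)
    (summable_strideTwo (abs_delayCoeff_le a k) 1 y), tsum_mul_left]

/-- A forced harmonic oscillator `u' = -w² v + g`, `v' = u` whose forcing is bounded by `G`
has phase-space radius growing at most at rate `G`. -/
lemma norm_oscillator_le {w T G : ℝ} {u v g : ℝ → ℝ}
    (hu : ∀ s, HasDerivAt u (-w ^ 2 * v s + g s) s) (hv : ∀ s, HasDerivAt v (u s) s)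
    (hg : ∀ s ∈ Set.Icc (0 : ℝ) T, |g s| ≤ G) {s : ℝ} (hs : s ∈ Set.Icc (0 : ℝ) T) :
    ‖(u s : ℂ) + (w * v s : ℝ) * Complex.I‖ ≤
      ‖(u 0 : ℂ) + (w * v 0 : ℝ) * Complex.I‖ + G * s := by
  set f : ℝ → ℂ := fun s =>
    Complex.exp ((-w * s : ℝ) * Complex.I) * ((u s : ℂ) + (w * v s : ℝ) * Complex.I)
  have hf : ∀ x, HasDerivAt f (Complex.exp ((-w * x : ℝ) * Complex.I) * (g x : ℂ)) x := by
    intro x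
    have h1 : HasDerivAt (fun s : ℝ => Complex.exp ((-w * s : ℝ) * Complex.I))
        (Complex.exp ((-w * x : ℝ) * Complex.I) * ((-w * 1 : ℝ) * Complex.I)) x :=
      ((((hasDerivAt_id x).const_mul (-w)).ofReal_comp).mul_const Complex.I).cexp
    have h2 := (hu x).ofReal_comp.add
      ((((hv x).const_mul w).ofReal_comp).mul_const Complex.I)
    refine (h1.mul h2).congr_deriv ?_
    simp only [Pi.add_apply]
    push_cast
    linear_combination -(Complex.exp (-(w : ℂ) * x * Complex.I) * w ^ 2 * v x) * Complex.I_sq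
  have hnorm : ∀ x, ‖f x‖ = ‖(u x : ℂ) + (w * v x : ℝ) * Complex.I‖ := fun x => by
    simp only [f, norm_mul, Complex.norm_exp_ofReal_mul_I, one_mul]
  have key := norm_image_sub_le_of_norm_deriv_le_segment' (f := f) (C := G)
    (fun x _ => (hf x).hasDerivWithinAt) (fun x hx => by
      rw [norm_mul, Complex.norm_exp_ofReal_mul_I, one_mul, Complex.norm_real]
      exact hg x (Set.Ico_subset_Icc_self hx)) s hs
  rw [← hnorm, ← hnorm]
  have := norm_le_norm_add_norm_sub' (f s) (f 0)
  simp only [sub_zero] at key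
  linarith

lemma norm_delay_kernel_le {w T : ℝ} (hw : 0 < w) (k : ℕ) :
    ∀ s ∈ Set.Icc (0 : ℝ) T,
      ‖(strideTwoSeries (delayCoeff (-w ^ 2) k) 0 s : ℂ) +
        (w * strideTwoSeries (delayCoeff (-w ^ 2) k) 1 s : ℝ) * Complex.I‖ ≤ (T / w) ^ k := by
  induction k with
  | zero =>
    intro s hs
    have h := norm_oscillator_le (w := w) (G := 0) (g := fun _ => 0)
      (fun s => by simpa using hasDerivAt_delayCoeff_zero (-w ^ 2) s)
      (hasDerivAt_strideTwoSeries_succ (abs_delayCoeff_le (-w ^ 2) 0) 0) (by simp) hs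
    simpa [strideTwoSeries_zero_arg_zero, strideTwoSeries_zero_arg_one, delayCoeff] using h
  | succ k ih =>
    intro s hs
    have hT : 0 ≤ T := hs.1.trans hs.2
    have hg : ∀ s ∈ Set.Icc (0 : ℝ) T,
        |strideTwoSeries (delayCoeff (-w ^ 2) k) 1 s| ≤ (T / w) ^ k / w := by
      intro s hs
      rw [le_div_iff₀ hw, mul_comm]
      have h := (Complex.abs_im_le_norm _).trans (ih s hs)
      simpa [abs_mul, abs_of_pos hw] using h
    have h := norm_oscillator_le (w := w) (hasDerivAt_delayCoeff_succ (-w ^ 2) k)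
      (hasDerivAt_strideTwoSeries_succ (abs_delayCoeff_le (-w ^ 2) (k + 1)) 0) hg hs
    rw [strideTwoSeries_zero_arg_zero, strideTwoSeries_zero_arg_one] at h
    refine h.trans ?_
    have h0 : delayCoeff (-w ^ 2) (k + 1) 0 = 0 := by simp [delayCoeff]
    rw [h0]
    simp only [mul_zero, Complex.ofReal_zero, zero_mul, add_zero, norm_zero, zero_add]
    calc (T / w) ^ k / w * s ≤ (T / w) ^ k / w * T := by gcongr; exact hs.2
      _ = (T / w) ^ (k + 1) := by rw [pow_succ]; ring

lemma abs_delay_cos_kernel_le {w T s : ℝ} (hw : 0 < w) (k : ℕ) (hs : s ∈ Set.Icc (0 : ℝ) T) :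
    |strideTwoSeries (delayCoeff (-w ^ 2) k) 0 s| ≤ (T / w) ^ k := by
  simpa using (Complex.abs_re_le_norm _).trans (norm_delay_kernel_le hw k s hs)

lemma abs_delay_sin_kernel_le {w T s : ℝ} (hw : 0 < w) (k : ℕ) (hs : s ∈ Set.Icc (0 : ℝ) T) :
    w * |strideTwoSeries (delayCoeff (-w ^ 2) k) 1 s| ≤ (T / w) ^ k := by
  simpa [abs_mul, abs_of_pos hw] using
    (Complex.abs_im_le_norm _).trans (norm_delay_kernel_le hw k s hs)

lemma tsum_Cterm (τ a b t : ℝ) (k : ℕ) :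
    ∑' m, Cterm τ a b t k m =
      b ^ k * strideTwoSeries (delayCoeff a k) 0 (max (t - k * τ) 0) := by
  rw [strideTwoSeries, ← tsum_mul_left]
  congr 1 with m
  unfold Cterm delayCoeff
  split_ifs with h
  · simp only [add_zero]; ring
  · simp [Nat.choose_eq_zero_of_lt (not_le.mp h)]

lemma tsum_Sterm (τ a b t : ℝ) (k : ℕ) :
    ∑' m, Sterm τ a b t k m =
      b ^ k * strideTwoSeries (delayCoeff a k) 1 (max (t - k * τ) 0) := by
  rw [strideTwoSeries, ← tsum_mul_left]
  congr 1 with m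
  unfold Sterm delayCoeff
  split_ifs with h
  · ring
  · simp [Nat.choose_eq_zero_of_lt (not_le.mp h)]

lemma max_sub_mul_eq_zero {τ t : ℝ} {N k : ℕ} (hτ : 0 ≤ τ) (ht : t ≤ N * τ) (hk : N ≤ k) :
    max (t - k * τ) 0 = 0 := by
  have : (N : ℝ) * τ ≤ k * τ := by gcongr
  exact max_eq_right (by linarith)

lemma Cdel_eq_sum {τ a b t : ℝ} {N : ℕ} (hτ : 0 ≤ τ) (ht : t ∈ Set.Icc 0 (N * τ)) :
    Cdel τ a b t = ∑ k ∈ Finset.range (N - 1 + 1),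
      b ^ k * strideTwoSeries (delayCoeff a k) 0 (max (t - k * τ) 0) := by
  rw [Cdel, if_neg (not_lt.mpr ht.1)]
  simp only [tsum_Cterm]
  refine tsum_eq_sum fun k hk => ?_
  rw [Finset.mem_range] at hk
  obtain ⟨j, rfl⟩ : ∃ j, k = j + 1 := ⟨k - 1, by omega⟩
  rw [max_sub_mul_eq_zero hτ ht.2 (by omega), strideTwoSeries_zero_arg_zero]
  simp [delayCoeff]

lemma Sdel_eq_sum {τ a b t : ℝ} {N : ℕ} (hτ : 0 ≤ τ) (ht : t ∈ Set.Icc 0 (N * τ)) :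
    Sdel τ a b t = ∑ k ∈ Finset.range (N - 1 + 1),
      b ^ k * strideTwoSeries (delayCoeff a k) 1 (max (t - k * τ) 0) := by
  rw [Sdel, if_neg (not_lt.mpr ht.1)]
  simp only [tsum_Sterm]
  refine tsum_eq_sum fun k hk => ?_
  rw [Finset.mem_range] at hk
  rw [max_sub_mul_eq_zero hτ ht.2 (by omega), strideTwoSeries_zero_arg_one, mul_zero]

lemma max_sub_mem_Icc {τ t T : ℝ} (hτ : 0 ≤ τ) (ht : t ∈ Set.Icc 0 T) (k : ℕ) :
    max (t - k * τ) 0 ∈ Set.Icc 0 T := by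
  have : 0 ≤ (k : ℝ) * τ := by positivity
  exact ⟨le_max_right _ _, max_le (by linarith [ht.2]) (ht.1.trans ht.2)⟩

/-- If `p x ≤ w` and `v² ≤ q x²`, the `k`-th weight `v^(2k) (T/w)^k` grows at most like `x^k`. -/
lemma delay_weight_le {p q T w v x : ℝ} {k J : ℕ} (hp : 0 < p) (hq : 0 ≤ q) (hT : 0 ≤ T)
    (hx : 1 ≤ x) (hw : p * x ≤ w) (hv : v ^ 2 ≤ q * x ^ 2) (hk : k ≤ J) :
    |(-v ^ 2) ^ k| * (T / w) ^ k ≤ (q * T / p) ^ k * x ^ J := by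
  have hx0 : 0 < x := by linarith
  have hw0 : 0 < w := lt_of_lt_of_le (by positivity) hw
  rw [abs_pow, abs_neg, abs_of_nonneg (sq_nonneg v), ← mul_pow]
  calc (v ^ 2 * (T / w)) ^ k ≤ ((q * x ^ 2) * (T / (p * x))) ^ k := by gcongr
    _ = (q * T / p) ^ k * x ^ k := by
        rw [← mul_pow]; congr 1; field_simp
    _ ≤ _ := by gcongr

lemma abs_Cdel_le {τ p q w v x t : ℝ} {N : ℕ} (hτ : 0 ≤ τ) (hp : 0 < p) (hq : 0 ≤ q)
    (hx : 1 ≤ x) (hw : p * x ≤ w) (hv : v ^ 2 ≤ q * x ^ 2) (ht : t ∈ Set.Icc 0 (N * τ)) :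
    |Cdel τ (-w ^ 2) (-v ^ 2) t| ≤
      (∑ k ∈ Finset.range (N - 1 + 1), (q * (N * τ) / p) ^ k) * x ^ (N - 1) := by
  have hw0 : 0 < w := lt_of_lt_of_le (by positivity) hw
  rw [Cdel_eq_sum hτ ht, Finset.sum_mul]
  refine (Finset.abs_sum_le_sum_abs _ _).trans (Finset.sum_le_sum fun k hk => ?_)
  rw [abs_mul]
  exact (mul_le_mul_of_nonneg_left (abs_delay_cos_kernel_le hw0 k (max_sub_mem_Icc hτ ht k))
    (abs_nonneg _)).trans (delay_weight_le hp hq (by positivity) hx hw hv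
      (Nat.lt_succ_iff.mp (Finset.mem_range.mp hk)))

lemma abs_Sdel_le {τ p q w v x t : ℝ} {N : ℕ} (hτ : 0 ≤ τ) (hp : 0 < p) (hq : 0 ≤ q)
    (hx : 1 ≤ x) (hw : p * x ≤ w) (hv : v ^ 2 ≤ q * x ^ 2) (ht : t ∈ Set.Icc 0 (N * τ)) :
    w * |Sdel τ (-w ^ 2) (-v ^ 2) t| ≤
      (∑ k ∈ Finset.range (N - 1 + 1), (q * (N * τ) / p) ^ k) * x ^ (N - 1) := by
  have hw0 : 0 < w := lt_of_lt_of_le (by positivity) hw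
  rw [Sdel_eq_sum hτ ht, Finset.sum_mul]
  refine (mul_le_mul_of_nonneg_left (Finset.abs_sum_le_sum_abs _ _) hw0.le).trans ?_
  rw [Finset.mul_sum]
  refine Finset.sum_le_sum fun k hk => ?_
  rw [abs_mul, mul_left_comm]
  exact (mul_le_mul_of_nonneg_left (abs_delay_sin_kernel_le hw0 k (max_sub_mem_Icc hτ ht k))
    (abs_nonneg _)).trans (delay_weight_le hp hq (by positivity) hx hw hv
      (Nat.lt_succ_iff.mp (Finset.mem_range.mp hk)))

/-- If `(x α)² - d > 0` at `x = 1`, the frequency `√((x α)² - d)` is at least linear in `x`. -/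
lemma exists_linear_lower_bound {α d : ℝ} (hα : 0 < α) (h1 : 0 < α ^ 2 - d) :
    ∃ p : ℝ, 0 < p ∧ ∀ x : ℝ, 1 ≤ x → p * x ≤ √((x * α) ^ 2 - d) := by
  have hc : 0 < min (α ^ 2) (α ^ 2 - d) := lt_min (by positivity) h1
  refine ⟨√(min (α ^ 2) (α ^ 2 - d)), Real.sqrt_pos.mpr hc, fun x hx => ?_⟩
  apply Real.le_sqrt_of_sq_le
  rw [mul_pow, Real.sq_sqrt hc.le]
  have hx2 : 1 ≤ x ^ 2 := one_le_pow₀ hx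
  rcases le_total d 0 with hd | hd
  · nlinarith [mul_le_mul_of_nonneg_right (min_le_left (α ^ 2) (α ^ 2 - d)) (sq_nonneg x)]
  · nlinarith [mul_le_mul_of_nonneg_right (min_le_right (α ^ 2) (α ^ 2 - d)) (sq_nonneg x)]

/-- polynomial-in-`n` kernel bounds: with `T = Nτ`, `K = ⌈T/τ⌉`,
`ωₙ = √((nπa₁/L)² − d₁)` and `υₙ = √((nπa₂/L)² − d₂)` (both radicands positive), there
is a constant `M > 0` (depending on `T` but not on `n`) such that for all `n ≥ 1` and
`t ∈ [0,T]`: `|C_τ^{−ωₙ²,−υₙ²}(t)| ≤ M·n^K`, `|S_τ^{−ωₙ²,−υₙ²}(t)| ≤ M·n^{K−1}`, and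
`|υₙ²·S_τ^{−ωₙ²,−υₙ²}(t)| ≤ M·n^{K+1}`. -/
theorem kernel_polynomial_bounds (τ : ℝ) (hτ : 0 < τ) (N : ℕ)
    (T : ℝ) (hT : T = (N : ℝ) * τ) (K : ℕ) (hK : K = ⌈T / τ⌉₊)
    (L a₁ a₂ : ℝ) (hL : 0 < L) (ha₁ : 0 < a₁) (ha₂ : 0 < a₂) (d₁ d₂ : ℝ)
    (hpos₁ : ∀ n : ℕ, 0 < n → 0 < ((n : ℝ) * Real.pi * a₁ / L) ^ 2 - d₁)
    (hpos₂ : ∀ n : ℕ, 0 < n → 0 < ((n : ℝ) * Real.pi * a₂ / L) ^ 2 - d₂)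
    (ω υ : ℕ → ℝ)
    (hω : ∀ n : ℕ, ω n = Real.sqrt (((n : ℝ) * Real.pi * a₁ / L) ^ 2 - d₁))
    (hυ : ∀ n : ℕ, υ n = Real.sqrt (((n : ℝ) * Real.pi * a₂ / L) ^ 2 - d₂)) :
    ∃ M : ℝ, 0 < M ∧ ∀ n : ℕ, 0 < n → ∀ t ∈ Set.Icc (0 : ℝ) T,
      |Cdel τ (-(ω n) ^ 2) (-(υ n) ^ 2) t| ≤ M * (n : ℝ) ^ K ∧
      |Sdel τ (-(ω n) ^ 2) (-(υ n) ^ 2) t| ≤ M * (n : ℝ) ^ (K - 1) ∧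
      |(υ n) ^ 2 * Sdel τ (-(ω n) ^ 2) (-(υ n) ^ 2) t| ≤ M * (n : ℝ) ^ (K + 1) := by
  have hKN : K = N := by
    rw [hK, hT, mul_div_cancel_right₀ _ hτ.ne', Nat.ceil_natCast]
  subst hKN hT
  obtain ⟨p, hp, hpw⟩ := exists_linear_lower_bound (α := Real.pi * a₁ / L) (d := d₁)
    (by positivity) (by simpa using hpos₁ 1 one_pos)
  set q : ℝ := (Real.pi * a₂ / L) ^ 2 + |d₂| with hq_def
  have hq : 0 ≤ q := by positivity
  set M₀ : ℝ := ∑ k ∈ Finset.range (K - 1 + 1), (q * (K * τ) / p) ^ k with hM₀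
  have hM₀_pos : 0 < M₀ := by
    rw [hM₀, Finset.sum_range_succ', pow_zero]
    positivity
  refine ⟨M₀ + M₀ / p + q * (M₀ / p), by positivity, fun n hn t ht => ?_⟩
  have hx : (1 : ℝ) ≤ n := by exact_mod_cast hn
  have hx0 : (0 : ℝ) < n := by positivity
  have hw : p * n ≤ ω n := by
    rw [hω, mul_assoc, mul_div_assoc]
    exact hpw n hx
  have hv : (υ n) ^ 2 ≤ q * (n : ℝ) ^ 2 := by
    rw [hυ, Real.sq_sqrt (hpos₂ n hn).le, hq_def, mul_assoc, mul_div_assoc, mul_pow]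
    nlinarith [neg_abs_le d₂, abs_nonneg d₂, one_le_pow₀ (n := 2) hx]
  have hC := abs_Cdel_le hτ.le hp hq hx hw hv ht
  have hS : n * |Sdel τ (-(ω n) ^ 2) (-(υ n) ^ 2) t| ≤ M₀ / p * (n : ℝ) ^ (K - 1) := by
    rw [div_mul_eq_mul_div, le_div_iff₀ hp, mul_comm, ← mul_assoc]
    exact (mul_le_mul_of_nonneg_right hw (abs_nonneg _)).trans
      (abs_Sdel_le hτ.le hp hq hx hw hv ht)
  have hMp : 0 ≤ M₀ / p := by positivity
  have hqM : 0 ≤ q * (M₀ / p) := by positivity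
  refine ⟨hC.trans ?_, ?_, ?_⟩
  · exact mul_le_mul (by linarith) (pow_le_pow_right₀ hx (Nat.sub_le K 1)) (by positivity)
      (by positivity)
  · refine (le_mul_of_one_le_left (abs_nonneg _) hx).trans (hS.trans ?_)
    gcongr
    linarith
  · rw [abs_mul, abs_of_nonneg (sq_nonneg _)]
    calc (υ n) ^ 2 * |Sdel τ (-(ω n) ^ 2) (-(υ n) ^ 2) t|
        ≤ q * (n : ℝ) ^ 2 * |Sdel τ (-(ω n) ^ 2) (-(υ n) ^ 2) t| := by gcongr
      _ = q * n * (n * |Sdel τ (-(ω n) ^ 2) (-(υ n) ^ 2) t|) := by ring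
      _ ≤ q * n * (M₀ / p * (n : ℝ) ^ (K - 1)) := by gcongr
      _ = q * (M₀ / p) * (n : ℝ) ^ (K - 1 + 1) := by ring
      _ ≤ _ := mul_le_mul (by linarith) (pow_le_pow_right₀ hx (by omega)) (by positivity)
          (by positivity)
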